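/- Let A be an abelian group of the form A = B ⊕ D, where B is a torsion divisible group and D is a torsion-free group such that every short exact sequence 0 → D → X → ℚ → 0 of abelian groups splits. Then every short exact sequence 0 → A →φ Y →ψ C → 0 of abelian groups that is a t-extension splits: there exists a group homomorphism s : C → Y with ψ ∘ s = id_C. -/

import Mathlib

universe u

/-- A divisible abelian group satisfies Baer's criterion over `ℤ`. -/
theorem baer_int_of_nsmul_surjective {A : Type*} [AddCommGroup A]
    (h : ∀ a : A, ∀ n : ℕ, 0 < n → ∃ x : A, n • x = a) : Module.Baer ℤ A := by
  let _ : DivisibleBy A ℕ := divisibleByOfSMulRightSurj A ℕ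
    fun {n} hn a => h a n (Nat.pos_of_ne_zero hn)
  let _ : DivisibleBy A ℤ := AddGroup.divisibleByIntOfDivisibleByNat A
  exact Module.Baer.of_divisible A

theorem nsmul_surjective_of_rat_module {E : Type*} [AddCommGroup E] [Module ℚ E]
    (a : E) (n : ℕ) (hn : 0 < n) : ∃ x : E, n • x = a := by
  refine ⟨(n : ℚ)⁻¹ • a, ?_⟩
  rw [← Nat.cast_smul_eq_nsmul ℚ, smul_smul, mul_inv_cancel₀ (by positivity), one_smul]

theorem eq_zero_of_isOfFinAddOrder_of_rat_module {E : Type*} [AddCommGroup E] [Module ℚ E]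
    {e : E} (he : IsOfFinAddOrder e) : e = 0 := by
  obtain ⟨n, hn, h⟩ := isOfFinAddOrder_iff_nsmul_eq_zero.1 he
  rw [← Nat.cast_smul_eq_nsmul ℚ] at h
  exact (smul_eq_zero.1 h).resolve_left (by positivity)

/-- Every abelian group maps to a rational vector space with torsion kernel. -/
theorem exists_rat_module_hom_ker_torsion (C : Type u) [AddCommGroup C] :
    ∃ (V : Type u) (_ : AddCommGroup V) (_ : Module ℚ V) (j : C →+ V),
      ∀ c, j c = 0 → IsOfFinAddOrder c := by
  refine ⟨TensorProduct ℤ ℚ C, inferInstance, inferInstance,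
    (TensorProduct.mk ℤ ℚ C 1).toAddMonoidHom, fun c hc => ?_⟩
  have : IsLocalizedModule (nonZeroDivisors ℤ) (TensorProduct.mk ℤ ℚ C 1) :=
    (isLocalizedModule_iff_isBaseChange (nonZeroDivisors ℤ) ℚ _).2
      (TensorProduct.isBaseChange ℤ C ℚ)
  obtain ⟨n, hn⟩ := (IsLocalizedModule.eq_zero_iff (nonZeroDivisors ℤ)
    (TensorProduct.mk ℤ ℚ C 1)).1 hc
  exact isOfFinAddOrder_iff_zsmul_eq_zero.2 ⟨n, nonZeroDivisors.coe_ne_zero n, hn⟩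

/-- If every extension of `D` by `ℚ` splits, then homomorphisms from `ℚ` lift along every
surjection with kernel `D`. -/
theorem exists_lift_rat_of_cotorsion {D E Q : Type u} [AddCommGroup D] [AddCommGroup E]
    [AddCommGroup Q]
    (hcot : ∀ (X : Type u) (_ : AddCommGroup X) (ι : D →+ X) (π : X →+ ℚ),
      Function.Injective ι → Function.Surjective π →
      (∀ x : X, π x = 0 ↔ x ∈ ι.range) →
      ∃ s : ℚ →+ X, π.comp s = AddMonoidHom.id ℚ)
    (i : D →+ E) (q : E →+ Q) (hi : Function.Injective i) (hq : Function.Surjective q)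
    (hiq : ∀ e, q e = 0 ↔ e ∈ i.range) (h : ℚ →+ Q) :
    ∃ l : ℚ →+ E, q.comp l = h := by
  let P : AddSubgroup (E × ℚ) :=
    (q.comp (AddMonoidHom.fst E ℚ) - h.comp (AddMonoidHom.snd E ℚ)).ker
  have hP : ∀ x : E × ℚ, x ∈ P ↔ q x.1 = h x.2 := fun x => by
    simp [P, AddMonoidHom.mem_ker, sub_eq_zero]
  obtain ⟨s, hs⟩ := hcot P inferInstance
    ((AddMonoidHom.prod i 0).codRestrict P fun d => (hP _).2 (by
      simpa using (hiq (i d)).2 ⟨d, rfl⟩))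
    ((AddMonoidHom.snd E ℚ).comp P.subtype)
    (fun a b hab => hi (congrArg (fun x : P => x.1.1) hab))
    (fun r => by
      obtain ⟨e, he⟩ := hq (h r)
      exact ⟨⟨(e, r), (hP _).2 he⟩, rfl⟩)
    (fun x => by
      obtain ⟨⟨e, r⟩, hx⟩ := x
      rw [hP] at hx
      constructor
      · intro hr
        obtain rfl : r = 0 := hr
        obtain ⟨d, hd⟩ := (hiq e).1 (by simpa using hx)
        exact ⟨d, Subtype.ext (Prod.ext hd rfl)⟩
      · rintro ⟨d, hd⟩
        exact (congrArg (fun x : P => x.1.2) hd).symm)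
  refine ⟨(AddMonoidHom.fst E ℚ).comp (P.subtype.comp s), AddMonoidHom.ext fun r => ?_⟩
  have h1 := (hP (s r).1).1 (s r).2
  have h2 : (s r).1.2 = r := DFunLike.congr_fun hs r
  rw [h2] at h1
  exact h1

/-- Homomorphisms from a rational vector space lift along a homomorphism of abelian groups as
soon as homomorphisms from `ℚ` do. -/
theorem exists_lift_rat_module {E Q V : Type*} [AddCommGroup E] [Module ℚ E] [AddCommGroup Q]
    [AddCommGroup V] [Module ℚ V] (q : E →+ Q)
    (hlift : ∀ h : ℚ →+ Q, ∃ l : ℚ →+ E, q.comp l = h) (h : V →+ Q) :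
    ∃ l : V →+ E, q.comp l = h := by
  let b := Module.Basis.ofVectorSpace ℚ V
  choose l hl using fun k => hlift (h.comp (LinearMap.toSpanSingleton ℚ V (b k)).toAddMonoidHom)
  refine ⟨(b.constr ℚ fun k => l k 1).toAddMonoidHom, AddMonoidHom.ext fun v => ?_⟩
  rw [← b.linearCombination_repr v]
  induction b.repr v using Finsupp.induction_linear with
  | zero => simp
  | add x y hx hy => rw [map_add, map_add, map_add, hx, hy]
  | single k r =>
    have h1 : r • l k 1 = l k r := by
      rw [← map_rat_smul (l k) r (1 : ℚ)]; simp
    have h2 := DFunLike.congr_fun (hl k) r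
    simpa [h1] using h2

/-- Homomorphisms killing torsion lift along a surjection from a rational vector space with
cotorsion kernel. -/
theorem exists_lift_of_cotorsion {D E Q C : Type u} [AddCommGroup D] [AddCommGroup E]
    [Module ℚ E] [AddCommGroup Q] [AddCommGroup C]
    (hcot : ∀ (X : Type u) (_ : AddCommGroup X) (ι : D →+ X) (π : X →+ ℚ),
      Function.Injective ι → Function.Surjective π →
      (∀ x : X, π x = 0 ↔ x ∈ ι.range) →
      ∃ s : ℚ →+ X, π.comp s = AddMonoidHom.id ℚ)
    (i : D →+ E) (q : E →+ Q) (hi : Function.Injective i) (hq : Function.Surjective q)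
    (hiq : ∀ e, q e = 0 ↔ e ∈ i.range) (h : C →+ Q)
    (htor : ∀ c, IsOfFinAddOrder c → h c = 0) :
    ∃ l : C →+ E, q.comp l = h := by
  obtain ⟨V, _, _, j, hj⟩ := exists_rat_module_hom_ker_torsion C
  have hQ : Module.Baer ℤ Q := baer_int_of_nsmul_surjective fun a n hn => by
    obtain ⟨e, rfl⟩ := hq a
    obtain ⟨x, rfl⟩ := nsmul_surjective_of_rat_module e n hn
    exact ⟨q x, (map_nsmul q n x).symm⟩
  obtain ⟨h', hh'⟩ := hQ.extension_property_addMonoidHom (QuotientAddGroup.kerLift j)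
    (QuotientAddGroup.kerLift_injective j)
    (QuotientAddGroup.lift j.ker h fun c hc => htor c (hj c hc))
  obtain ⟨l, hl⟩ := exists_lift_rat_module q
    (exists_lift_rat_of_cotorsion hcot i q hi hq hiq) h'
  refine ⟨l.comp j, AddMonoidHom.ext fun c => ?_⟩
  exact (DFunLike.congr_fun hl (j c)).trans
    (DFunLike.congr_fun hh' (QuotientAddGroup.mk c))

/-- A homomorphism to a torsion-free cotorsion group extends along an injection whose cokernel
has only torsion that lifts to torsion. -/
theorem exists_extension_of_torsionFree_cotorsion {D A Y C : Type u} [AddCommGroup D]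
    [AddCommGroup A] [AddCommGroup Y] [AddCommGroup C]
    (hD : ∀ d : D, IsOfFinAddOrder d → d = 0)
    (hcot : ∀ (X : Type u) (_ : AddCommGroup X) (ι : D →+ X) (π : X →+ ℚ),
      Function.Injective ι → Function.Surjective π →
      (∀ x : X, π x = 0 ↔ x ∈ ι.range) →
      ∃ s : ℚ →+ X, π.comp s = AddMonoidHom.id ℚ)
    (φ : A →+ Y) (ψ : Y →+ C) (hφ : Function.Injective φ) (hψ : Function.Surjective ψ)
    (hex : ∀ y : Y, ψ y = 0 ↔ y ∈ φ.range)
    (htor : ∀ c : C, IsOfFinAddOrder c → ∃ y : Y, IsOfFinAddOrder y ∧ ψ y = c)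
    (f : A →+ D) : ∃ g : Y →+ D, g.comp φ = f := by
  obtain ⟨E, _, _, i, hi⟩ := exists_rat_module_hom_ker_torsion D
  have hi' : Function.Injective i :=
    (injective_iff_map_eq_zero i).2 fun d hd => hD d (hi d hd)
  obtain ⟨g, hg⟩ := (baer_int_of_nsmul_surjective
    (nsmul_surjective_of_rat_module (E := E))).extension_property_addMonoidHom φ hφ (i.comp f)
  have hgφ : ∀ a, g (φ a) = i (f a) := DFunLike.congr_fun hg
  let q := QuotientAddGroup.mk' i.range
  have hiq : ∀ e, q e = 0 ↔ e ∈ i.range := QuotientAddGroup.eq_zero_iff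
  have hker : ψ.ker ≤ (q.comp g).ker := fun y hy => by
    obtain ⟨a, rfl⟩ := (hex y).1 hy
    exact (hiq _).2 ⟨f a, (hgφ a).symm⟩
  let h : C →+ E ⧸ i.range := ψ.liftOfSurjective hψ ⟨q.comp g, hker⟩
  have hh : ∀ y, h (ψ y) = q (g y) := fun y =>
    ψ.liftOfRightInverse_comp_apply _ (Function.rightInverse_surjInv hψ) ⟨q.comp g, hker⟩ y
  obtain ⟨l, hl⟩ := exists_lift_of_cotorsion hcot i q hi' (QuotientAddGroup.mk'_surjective _)
    hiq h fun c hc => by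
      obtain ⟨y, hy, rfl⟩ := htor c hc
      rw [hh, eq_zero_of_isOfFinAddOrder_of_rat_module (g.isOfFinAddOrder hy), map_zero]
  have hrange : ∀ y, (g - l.comp ψ) y ∈ i.range := fun y => by
    rw [← hiq]
    have := DFunLike.congr_fun hl (ψ y)
    simp only [AddMonoidHom.comp_apply] at this
    simp [this, hh]
  refine ⟨(AddMonoidHom.ofInjective hi').symm.toAddMonoidHom.comp
    ((g - l.comp ψ).codRestrict i.range hrange), AddMonoidHom.ext fun a => ?_⟩
  refine (AddMonoidHom.ofInjective hi').symm_apply_eq.2 (Subtype.ext ?_)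
  have : ψ (φ a) = 0 := (hex _).2 ⟨a, rfl⟩
  rw [AddMonoidHom.ofInjective_apply]
  simp [this, hgφ]

/-- A retraction of the left map of a short exact sequence gives a section of the right map. -/
theorem exists_section_of_retraction {A Y C : Type*} [AddCommGroup A] [AddCommGroup Y]
    [AddCommGroup C] (φ : A →+ Y) (ψ : Y →+ C) (hψ : Function.Surjective ψ)
    (hex : ∀ y : Y, ψ y = 0 ↔ y ∈ φ.range)
    (ρ : Y →+ A) (hρ : ∀ a, ρ (φ a) = a) :
    ∃ s : C →+ Y, ψ.comp s = AddMonoidHom.id C := by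
  have hker : ψ.ker ≤ (AddMonoidHom.id Y - φ.comp ρ).ker := fun y hy => by
    obtain ⟨a, rfl⟩ := (hex y).1 hy
    simp [AddMonoidHom.mem_ker, hρ]
  refine ⟨ψ.liftOfSurjective hψ ⟨_, hker⟩, AddMonoidHom.ext fun c => ?_⟩
  obtain ⟨y, rfl⟩ := hψ c
  have h1 : ψ.liftOfSurjective hψ ⟨_, hker⟩ (ψ y) = y - φ (ρ y) :=
    ψ.liftOfRightInverse_comp_apply _ (Function.rightInverse_surjInv hψ) ⟨_, hker⟩ y
  have h2 : ψ (φ (ρ y)) = 0 := (hex _).2 ⟨_, rfl⟩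
  simp [h1, h2]

/-- Every t-extension of `B ⊕ D` splits, where `B` is torsion divisible and `D` is
torsion-free cotorsion. -/
theorem tExtension_splits_of_torsionDivisible_prod_torsionFreeCotorsion
    (B D : Type u) [AddCommGroup B] [AddCommGroup D]
    -- B is torsion:
    (hBtor : ∀ b : B, IsOfFinAddOrder b)
    -- B is divisible:
    (hBdiv : ∀ b : B, ∀ n : ℕ, 0 < n → ∃ x : B, n • x = b)
    -- D is torsion-free:
    (hD : ∀ d : D, IsOfFinAddOrder d → d = 0)
    -- D is cotorsion: every extension of D by ℚ splits:
    (hcot : ∀ (X : Type u) (_ : AddCommGroup X) (ι : D →+ X) (π : X →+ ℚ),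
      Function.Injective ι → Function.Surjective π →
      (∀ x : X, π x = 0 ↔ x ∈ ι.range) →
      ∃ s : ℚ →+ X, π.comp s = AddMonoidHom.id ℚ) :
    -- every t-extension of A = B ⊕ D splits:
    ∀ (Y C : Type u) (_ : AddCommGroup Y) (_ : AddCommGroup C)
      (φ : B × D →+ Y) (ψ : Y →+ C),
      Function.Injective φ → Function.Surjective ψ →
      (∀ y : Y, ψ y = 0 ↔ y ∈ φ.range) →
      (∀ c : C, IsOfFinAddOrder c → ∃ y : Y, IsOfFinAddOrder y ∧ ψ y = c) →
      (∀ y : Y, IsOfFinAddOrder y → ψ y = 0 →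
        ∃ a : B × D, IsOfFinAddOrder a ∧ φ a = y) →
      ∃ s : C →+ Y, ψ.comp s = AddMonoidHom.id C := by
  intro Y C _ _ φ ψ hφ hψ hex htor _
  obtain ⟨g, hg⟩ := exists_extension_of_torsionFree_cotorsion hD hcot φ ψ hφ hψ hex htor
    (AddMonoidHom.snd B D)
  obtain ⟨f, hf⟩ := (baer_int_of_nsmul_surjective hBdiv).extension_property_addMonoidHom φ hφ
    (AddMonoidHom.fst B D)
  exact exists_section_of_retraction φ ψ hψ hex (f.prod g) fun a =>
    Prod.ext (DFunLike.congr_fun hf a) (DFunLike.congr_fun hg a)
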